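/- Let d, r, p ∈ ℕ, let θ be an MSO sentence over the vocabulary {E, root, P_1,…,P_{r·p+1}} of trees in T_{d,r·p+1}, and let 𝒮 be a set of signatures S ⊆ {1,…,r}²×{1,…,d}. For every set T of MSO sentences over the vocabulary {E, P_1,…,P_p} of p-labeled graphs: if every finite subset of T is satisfiable by some graph in TM(r,p,d;θ,𝒮), then T is satisfiable by some graph in TM(r,p,d;θ,𝒮); moreover, T has an at most countable model in TM(r,p,d;θ,𝒮). -/

import Mathlib

open Cardinal

/-- The tower function: `tower 0 n = n`, `tower (d+1) n = 2 ^ tower d n`. -/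
def tower : ℕ → ℕ → ℕ
  | 0, n => n
  | d + 1, n => 2 ^ tower d n

/-- MSO formulas over the vocabulary consisting of one binary relation symbol `E`
and unary relation symbols indexed by `ι`.  First-order variables and set
variables are both indexed by `ℕ`. -/
inductive MSOForm (ι : Type u) : Type u
  | fal : MSOForm ι
  | eq : ℕ → ℕ → MSOForm ι
  | edge : ℕ → ℕ → MSOForm ι
  | pred : ι → ℕ → MSOForm ι
  | mem : ℕ → ℕ → MSOForm ι
  | imp : MSOForm ι → MSOForm ι → MSOForm ι
  | exFO : ℕ → MSOForm ι → MSOForm ι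
  | exSO : ℕ → MSOForm ι → MSOForm ι

namespace MSOForm

variable {ι : Type u}

/-- Quantifier rank: the maximum nesting depth of (first- and second-order) quantifiers. -/
def qr : MSOForm ι → ℕ
  | fal => 0
  | eq _ _ => 0
  | edge _ _ => 0
  | pred _ _ => 0
  | mem _ _ => 0
  | imp φ ψ => max φ.qr ψ.qr
  | exFO _ φ => φ.qr + 1
  | exSO _ φ => φ.qr + 1

/-- Free first-order variables. -/
def freeFO : MSOForm ι → Finset ℕ
  | fal => ∅
  | eq i j => {i, j}
  | edge i j => {i, j}
  | pred _ i => {i}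
  | mem i _ => {i}
  | imp φ ψ => φ.freeFO ∪ ψ.freeFO
  | exFO n φ => φ.freeFO.erase n
  | exSO _ φ => φ.freeFO

/-- Free set variables. -/
def freeSO : MSOForm ι → Finset ℕ
  | fal => ∅
  | eq _ _ => ∅
  | edge _ _ => ∅
  | pred _ _ => ∅
  | mem _ X => {X}
  | imp φ ψ => φ.freeSO ∪ ψ.freeSO
  | exFO _ φ => φ.freeSO
  | exSO X φ => φ.freeSO.erase X

/-- A sentence is a formula with no free variables of either kind. -/
def IsSentence (φ : MSOForm ι) : Prop := φ.freeFO = ∅ ∧ φ.freeSO = ∅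

/-- First-order formulas: no set quantification and no set membership. -/
def IsFO : MSOForm ι → Prop
  | fal => True
  | eq _ _ => True
  | edge _ _ => True
  | pred _ _ => True
  | mem _ _ => False
  | imp φ ψ => φ.IsFO ∧ ψ.IsFO
  | exFO _ φ => φ.IsFO
  | exSO _ _ => False

/-- Formulas that do not mention the binary relation symbol `E`
(i.e. formulas over a purely monadic vocabulary). -/
def NoEdge : MSOForm ι → Prop
  | fal => True
  | eq _ _ => True
  | edge _ _ => False
  | pred _ _ => True
  | mem _ _ => True
  | imp φ ψ => φ.NoEdge ∧ ψ.NoEdge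
  | exFO _ φ => φ.NoEdge
  | exSO _ φ => φ.NoEdge

end MSOForm

/-- A structure over the vocabulary with one binary relation `E` and `ι`-indexed
unary predicates: a universe, a binary relation and unary relations. -/
structure MStr (ι : Type u) where
  V : Type
  E : V → V → Prop
  P : ι → V → Prop

namespace MStr

/-- Satisfaction of an MSO formula under first-order and set variable assignments. -/
def Realize {ι : Type u} (M : MStr ι) : MSOForm ι → (ℕ → M.V) → (ℕ → Set M.V) → Prop
  | .fal, _, _ => False
  | .eq i j, v, _ => v i = v j
  | .edge i j, v, _ => M.E (v i) (v j)
  | .pred a i, v, _ => M.P a (v i)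
  | .mem i X, v, s => v i ∈ s X
  | .imp φ ψ, v, s => Realize M φ v s → Realize M ψ v s
  | .exFO n φ, v, s => ∃ x : M.V, Realize M φ (Function.update v n x) s
  | .exSO X φ, v, s => ∃ A : Set M.V, Realize M φ v (Function.update s X A)

/-- A structure satisfies a sentence. -/
def Sat {ι : Type u} (M : MStr ι) (φ : MSOForm ι) : Prop :=
  ∀ (v : ℕ → M.V) (s : ℕ → Set M.V), M.Realize φ v s

/-- `M ≡^MSO_m N` : `M` and `N` agree on all MSO sentences of quantifier rank at most `m`. -/
def MSOEquiv {ι : Type u} (m : ℕ) (M N : MStr ι) : Prop :=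
  ∀ φ : MSOForm ι, φ.IsSentence → φ.qr ≤ m → (M.Sat φ ↔ N.Sat φ)

/-- `M` and `N` agree on all MSO sentences. -/
def MSOEq {ι : Type u} (M N : MStr ι) : Prop :=
  ∀ φ : MSOForm ι, φ.IsSentence → (M.Sat φ ↔ N.Sat φ)

/-- `M ≡^FO_q N` over a purely monadic vocabulary: `M` and `N` agree on all
first-order sentences (not mentioning `E`) of quantifier rank at most `q`. -/
def FOEquiv {ι : Type u} (q : ℕ) (M N : MStr ι) : Prop :=
  ∀ φ : MSOForm ι, φ.IsFO → φ.NoEdge → φ.IsSentence → φ.qr ≤ q → (M.Sat φ ↔ N.Sat φ)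

end MStr

/-- A (finite or infinite) `p`-labeled graph: a simple undirected loop-free graph
each of whose vertices carries exactly one label from `Fin p`. -/
structure PGraph (p : ℕ) where
  V : Type
  adj : V → V → Prop
  symm : ∀ u v, adj u v → adj v u
  irrefl : ∀ v, ¬ adj v v
  label : V → Fin p

namespace PGraph

variable {p : ℕ}

/-- A `p`-labeled graph as a structure over the vocabulary `{E, P_1, …, P_p}`. -/
def toStr (G : PGraph p) : MStr (Fin p) :=
  ⟨G.V, G.adj, fun j v => G.label v = j⟩

/-- The induced labeled subgraph on a set of vertices (with the inherited labels). -/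
def induce (G : PGraph p) (s : Set G.V) : PGraph p where
  V := ↥s
  adj a b := G.adj a.1 b.1
  symm := fun _ _ h => G.symm _ _ h
  irrefl := fun _ h => G.irrefl _ h
  label := fun a => G.label a.1

/-- `G` is an induced labeled subgraph of `H` (up to isomorphism):
there is an injection of `G` into `H` preserving adjacency, non-adjacency and labels. -/
def Emb (G H : PGraph p) : Prop :=
  ∃ f : G.V → H.V, Function.Injective f ∧
    (∀ a b, G.adj a b ↔ H.adj (f a) (f b)) ∧ ∀ a, H.label (f a) = G.label a

end PGraph

/-- A tree model with `r` labels and height `d` for a `p`-labeled graph `G`: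
a rooted tree all of whose root-to-leaf paths have length exactly `d`, whose
leaves are exactly the vertices of `G`, each leaf carrying a pair `(i, j)` with
`i ∈ Fin r` (recorded by `iLab`) and `j` the label of the vertex in `G`,
together with a symmetric signature `S` determining adjacency from the leaf
labels and the distance in the tree. -/
structure TModel (r p d : ℕ) (G : PGraph p) where
  W : Type
  g : SimpleGraph W
  tree : g.IsTree
  root : W
  depthLe : ∀ w, g.dist root w ≤ d
  branch : ∀ w, g.dist root w < d → ∃ w', g.Adj w w' ∧ g.dist root w' = g.dist root w + 1
  leafEquiv : G.V ≃ {w : W // g.dist root w = d}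
  iLab : G.V → Fin r
  S : Set (Fin r × Fin r × ℕ)
  S_range : ∀ x ∈ S, 1 ≤ x.2.2 ∧ x.2.2 ≤ d
  S_symm : ∀ i j l, (i, j, l) ∈ S ↔ (j, i, l) ∈ S
  edge_iff : ∀ u v : G.V, u ≠ v → ∀ l : ℕ,
    g.dist (leafEquiv u).1 (leafEquiv v).1 = 2 * l →
      (G.adj u v ↔ (iLab u, iLab v, l) ∈ S)

/-- The class of all (finite or infinite) `p`-labeled graphs admitting a tree model
with `r` labels and height `d`. -/
def TM (r p d : ℕ) : Set (PGraph p) := {G | Nonempty (TModel r p d G)}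

/-- The underlying tree of a tree model, viewed as a structure over the
vocabulary `{E, root, P_1, …, P_{r·p+1}}` of trees of `T_{d, r·p+1}`: a leaf
with label pair `(i, j)` gets the label `i·p + j` (zero-based) and internal
nodes get the label `r·p`. -/
def TModel.toStr {r p d : ℕ} {G : PGraph p} (M : TModel r p d G) :
    MStr (Option (Fin (r * p + 1))) :=
  ⟨M.W, M.g.Adj, fun o w =>
    match o with
    | none => w = M.root
    | some k =>
        (∃ h : M.g.dist M.root w = d,
          (k : ℕ) = (M.iLab (M.leafEquiv.symm ⟨w, h⟩) : ℕ) * p +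
            (G.label (M.leafEquiv.symm ⟨w, h⟩) : ℕ)) ∨
        (¬ M.g.dist M.root w = d ∧ (k : ℕ) = r * p)⟩

/-- The subclass `TM(r,p,d; θ, 𝒮)` of `TM(r,p,d)` of graphs having a tree model
whose signature lies in `𝒮` and whose tree, viewed as a tree of `T_{d,r·p+1}`,
satisfies `θ`. -/
def TMc (r p d : ℕ) (θ : MSOForm (Option (Fin (r * p + 1))))
    (Sig : Set (Set (Fin r × Fin r × ℕ))) : Set (PGraph p) :=
  {G | ∃ M : TModel r p d G, M.S ∈ Sig ∧ M.toStr.Sat θ}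

/-- Two extended naturals agree up to the threshold `N`. -/
def CapEq (N : ℕ) (a b : ℕ∞) : Prop :=
  ∀ j : ℕ, j ≤ N → ((j : ℕ∞) ≤ a ↔ (j : ℕ∞) ≤ b)

namespace CapEq

lemma refl (N : ℕ) (a : ℕ∞) : CapEq N a a := fun _ _ => Iff.rfl

lemma symm {N : ℕ} {a b : ℕ∞} (h : CapEq N a b) : CapEq N b a := fun j hj => (h j hj).symm

lemma of_le {N : ℕ} {a b : ℕ∞} (ha : (N : ℕ∞) ≤ a) (hb : (N : ℕ∞) ≤ b) : CapEq N a b :=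
  fun j hj => ⟨fun _ => le_trans (by exact_mod_cast hj) hb,
    fun _ => le_trans (by exact_mod_cast hj) ha⟩

lemma eq_or_le {N : ℕ} {a b : ℕ∞} (h : CapEq N a b) :
    (a = b ∧ a < N) ∨ ((N : ℕ∞) ≤ a ∧ (N : ℕ∞) ≤ b) := by
  by_cases ha : (N : ℕ∞) ≤ a
  · exact Or.inr ⟨ha, (h N le_rfl).1 ha⟩
  · have hb : ¬ (N : ℕ∞) ≤ b := fun hb => ha ((h N le_rfl).2 hb)
    push Not at ha hb
    refine Or.inl ⟨?_, ha⟩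
    lift a to ℕ using ha.ne_top
    lift b to ℕ using hb.ne_top
    have ha' : a < N := by exact_mod_cast ha
    have hb' : b < N := by exact_mod_cast hb
    exact le_antisymm ((h a ha'.le).1 le_rfl) ((h b hb'.le).2 le_rfl)

lemma of_forall_fiber {α β K : Type} [Finite K] {N : ℕ} {A : Set α} {B : Set β}
    {σ : α → K} {τ : β → K}
    (h : ∀ k, CapEq N {a ∈ A | σ a = k}.encard {b ∈ B | τ b = k}.encard) :
    CapEq N A.encard B.encard := by
  by_cases hk : ∃ k, (N : ℕ∞) ≤ {a ∈ A | σ a = k}.encard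
  · obtain ⟨k, hk⟩ := hk
    exact of_le (hk.trans (Set.encard_le_encard fun _ h => h.1))
      (((h k N le_rfl).1 hk).trans (Set.encard_le_encard fun _ h => h.1))
  · push Not at hk
    have e : ∀ k, {a ∈ A | σ a = k}.encard = {b ∈ B | τ b = k}.encard := by
      intro k
      rcases (h k).eq_or_le with h1 | h1
      · exact h1.1
      · exact absurd h1.1 (hk k).not_ge
    have hA : A = ⋃ k, {a ∈ A | σ a = k} := by ext; simp
    have hB : B = ⋃ k, {b ∈ B | τ b = k} := by ext; simp
    rw [hA, hB, Set.encard_iUnion_of_finite, Set.encard_iUnion_of_finite, finsum_congr e]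
    · exact refl _ _
    · intro i j hij
      exact Set.disjoint_left.2 fun x hx hx' => hij (hx.2.symm.trans hx'.2)
    · intro i j hij
      exact Set.disjoint_left.2 fun x hx hx' => hij (hx.2.symm.trans hx'.2)

/-- If `A` and `B` have the same size up to a large threshold, then any colouring of `A` can be
transported to `B` preserving the sizes of the colour classes up to a smaller threshold. -/
lemma exists_map {α β K : Type} [Finite K] [Nonempty α] {N N' : ℕ}
    (hN : N * Nat.card K < N') {A : Set α} {B : Set β} (h : CapEq N' A.encard B.encard)
    (σ : α → K) :
    ∃ g : β → α, (∀ b ∈ B, g b ∈ A) ∧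
      ∀ k, CapEq N {b ∈ B | σ (g b) = k}.encard {a ∈ A | σ a = k}.encard := by
  classical
  rcases h.eq_or_le with ⟨h1, h2⟩ | ⟨h1, h2⟩
  · have hfin : B.Finite := Set.finite_of_encard_le_coe (h1 ▸ h2.le)
    obtain ⟨g, hg⟩ := hfin.exists_bijOn_of_encard_eq h1.symm
    refine ⟨g, hg.mapsTo, fun k => ?_⟩
    have : {a ∈ A | σ a = k} = g '' {b ∈ B | σ (g b) = k} := by
      rw [← hg.image_eq]; ext a; constructor
      · rintro ⟨⟨b, hb, rfl⟩, h⟩; exact ⟨b, ⟨hb, h⟩, rfl⟩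
      · rintro ⟨b, ⟨hb, h⟩, rfl⟩; exact ⟨⟨b, hb, rfl⟩, h⟩
    rw [this, (hg.injOn.mono fun _ h => h.1).encard_image]
    exact refl _ _
  · have hD : ∀ k, ∃ D ⊆ {a ∈ A | σ a = k}, D.encard = min (N : ℕ∞) {a ∈ A | σ a = k}.encard :=
      fun k => Set.exists_subset_encard_eq (min_le_right _ _)
    choose D hDs hDc using hD
    have hDN : ∀ k, (D k).encard ≤ N := fun k => (hDc k).le.trans (min_le_left _ _)
    have hle : (⋃ k, D k).encard ≤ (N * Nat.card K : ℕ) := by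
      have := Fintype.ofFinite K
      refine (Set.encard_iUnion_le_of_fintype _).trans
        ((Finset.sum_le_card_nsmul _ _ _ fun k _ => hDN k).trans ?_)
      simp [mul_comm]
    obtain ⟨k₀, hk₀⟩ : ∃ k, (N : ℕ∞) ≤ {a ∈ A | σ a = k}.encard := by
      by_contra hcon
      push Not at hcon
      have hDA : A ⊆ ⋃ k, D k := by
        intro a ha
        refine Set.mem_iUnion.2 ⟨σ a, ?_⟩
        have : D (σ a) = {x ∈ A | σ x = σ a} :=
          (Set.finite_of_encard_le_coe (hcon _).le).eq_of_subset_of_encard_le' (hDs _)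
            (by rw [hDc, min_eq_right (hcon _).le])
        rw [this]; exact ⟨ha, rfl⟩
      have : (N' : ℕ∞) ≤ (N * Nat.card K : ℕ) := h1.trans ((Set.encard_le_encard hDA).trans hle)
      exact absurd (by exact_mod_cast this) hN.not_ge
    have hNA : (D k₀).encard = N := by rw [hDc, min_eq_left hk₀]
    obtain ⟨a₀, ha₀⟩ : ∃ a, (A.Nonempty → a ∈ A) ∧ (0 < N → a ∈ D k₀) := by
      by_cases hN0 : 0 < N
      · have : (D k₀).Nonempty := by
          rw [← Set.encard_ne_zero, hNA]; exact_mod_cast hN0.ne'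
        obtain ⟨a, ha⟩ := this
        exact ⟨a, fun _ => (hDs _ ha).1, fun _ => ha⟩
      · by_cases hA : A.Nonempty
        · exact ⟨hA.some, fun _ => hA.some_mem, fun h => absurd h hN0⟩
        · exact ⟨Classical.arbitrary α, fun h => absurd h hA, fun h => absurd h hN0⟩
    have hAne : A.Nonempty := by
      rw [← Set.encard_ne_zero]
      intro h0
      rw [h0] at h1
      have : N' ≤ 0 := by exact_mod_cast h1
      omega
    have hUfin : (⋃ k, D k).Finite := Set.finite_of_encard_le_coe hle
    obtain ⟨E, hEB, hE⟩ := Set.exists_subset_encard_eq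
      (s := B) (k := (⋃ k, D k).encard) (hle.trans (le_trans (by exact_mod_cast hN.le) h2))
    obtain ⟨f, hf⟩ := (Set.finite_of_encard_le_coe (hE.le.trans hle)).exists_bijOn_of_encard_eq hE
    have hUA : ∀ a ∈ ⋃ k, D k, a ∈ A := by
      intro a ha
      obtain ⟨k, hk⟩ := Set.mem_iUnion.1 ha
      exact (hDs k hk).1
    refine ⟨fun b => if b ∈ E then f b else a₀, ?_, ?_⟩
    · intro b hb
      dsimp only
      split_ifs with h
      · exact hUA _ (hf.mapsTo h)
      · exact ha₀.1 hAne
    · intro k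
      have key : {b ∈ E | σ (f b) = k}.encard = (D k).encard := by
        have : D k = f '' {b ∈ E | σ (f b) = k} := by
          ext a; constructor
          · intro ha
            obtain ⟨b, hb, rfl⟩ := hf.surjOn (Set.mem_iUnion.2 ⟨k, ha⟩)
            exact ⟨b, ⟨hb, (hDs k ha).2⟩, rfl⟩
          · rintro ⟨b, ⟨hb, h⟩, rfl⟩
            obtain ⟨k', hk'⟩ := Set.mem_iUnion.1 (hf.mapsTo hb)
            have := (hDs _ hk').2
            rw [h] at this
            rwa [this]
        rw [this, (hf.injOn.mono fun _ h => h.1).encard_image]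
      have hsub : {b ∈ E | σ (f b) = k} ⊆ {b ∈ B | σ (if b ∈ E then f b else a₀) = k} := by
        rintro b ⟨hb, h⟩
        exact ⟨hEB hb, by simpa [hb] using h⟩
      by_cases hk : (N : ℕ∞) ≤ {a ∈ A | σ a = k}.encard
      · refine of_le ?_ hk
        refine le_trans ?_ (Set.encard_le_encard hsub)
        rw [key, hDc, min_eq_left hk]
      · have hN0 : 0 < N := by
          rcases Nat.eq_zero_or_pos N with h0 | h0
          · subst h0; simp at hk
          · exact h0
        have heq : {b ∈ B | σ (if b ∈ E then f b else a₀) = k} = {b ∈ E | σ (f b) = k} := by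
          refine subset_antisymm ?_ hsub
          rintro b ⟨hb, h⟩
          by_cases hbE : b ∈ E
          · exact ⟨hbE, by simpa [hbE] using h⟩
          · exfalso
            rw [if_neg hbE] at h
            have := (hDs _ (ha₀.2 hN0)).2
            rw [h] at this
            exact hk (this ▸ hk₀)
        rw [heq, key, hDc, min_eq_right (not_le.1 hk).le]
        exact refl _ _

end CapEq

/-- A rooted tree, given by its root, its depth function and its parent function. -/
structure RTree (W : Type) where
  root : W
  depth : W → ℕ
  par : W → W
  depth_eq_zero : ∀ x, depth x = 0 ↔ x = root
  depth_par : ∀ x, depth (par x) = depth x - 1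

/-- Types of coloured trees of a given height, where the children of nodes of height `h + 1` are
counted up to the threshold `N h`. -/
def TreeTy (N : ℕ → ℕ) (C : Type) : ℕ → Type
  | 0 => C
  | h + 1 => C × (TreeTy N C h → Fin (N h) → Prop)

instance TreeTy.instFinite (N : ℕ → ℕ) (C : Type) [Finite C] : ∀ h, Finite (TreeTy N C h)
  | 0 => inferInstanceAs (Finite C)
  | h + 1 => by
    have := TreeTy.instFinite N C h
    exact inferInstanceAs (Finite (C × (TreeTy N C h → Fin (N h) → Prop)))

namespace RTree

variable {W W' C : Type}

/-- `t.Child w a` says that `a` is a child of `w`. -/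
def Child (t : RTree W) (w a : W) : Prop := t.par a = w ∧ a ≠ t.root

lemma depth_root (t : RTree W) : t.depth t.root = 0 := (t.depth_eq_zero _).2 rfl

lemma par_root (t : RTree W) : t.par t.root = t.root :=
  (t.depth_eq_zero _).1 (by rw [t.depth_par, t.depth_root])

lemma Child.depth {t : RTree W} {w a : W} (h : t.Child w a) : t.depth a = t.depth w + 1 := by
  have h1 := t.depth_par a
  have h2 := mt (t.depth_eq_zero a).1 h.2
  rw [h.1] at h1
  omega

lemma depth_par_iterate (t : RTree W) (x : W) (i : ℕ) :
    t.depth (t.par^[i] x) = t.depth x - i := by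
  induction i with
  | zero => simp
  | succ i ih => rw [Function.iterate_succ_apply', t.depth_par, ih]; omega

/-- The type of the subtree of height `h` below a node. -/
def ty (t : RTree W) (N : ℕ → ℕ) (c : W → C) : (h : ℕ) → W → TreeTy N C h
  | 0, w => c w
  | h + 1, w => (c w, fun τ j =>
      (((j : ℕ) + 1 : ℕ) : ℕ∞) ≤ {a | t.Child w a ∧ ty t N c h a = τ}.encard)

/-- The colour of the root of a tree with a given type. -/
def _root_.TreeTy.color {N : ℕ → ℕ} : (h : ℕ) → TreeTy N C h → C
  | 0, τ => τ
  | _ + 1, τ => τ.1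

lemma color_ty (t : RTree W) (N : ℕ → ℕ) (c : W → C) (h : ℕ) (w : W) :
    (t.ty N c h w).color h = c w := by
  cases h <;> rfl

lemma ty_succ_eq_iff {t : RTree W} {t' : RTree W'} {N : ℕ → ℕ} {c : W → C} {c' : W' → C} {h : ℕ}
    {w : W} {w' : W'} :
    t.ty N c (h + 1) w = t'.ty N c' (h + 1) w' ↔ c w = c' w' ∧
      ∀ τ, CapEq (N h) {a | t.Child w a ∧ t.ty N c h a = τ}.encard
        {a | t'.Child w' a ∧ t'.ty N c' h a = τ}.encard := by
  refine Prod.mk.injEq _ _ _ _ ▸ and_congr_right fun _ =>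
    funext_iff.trans (forall_congr' fun τ => ⟨fun H j hj => ?_, fun H => funext fun j =>
      propext (H _ j.2)⟩)
  rcases j with _ | j
  · simp
  · exact iff_of_eq (congrFun H ⟨j, hj⟩)

/-- A map of coloured rooted trees. -/
structure IsHom (t : RTree W) (t' : RTree W') (c : W → C) (c' : W' → C) (g : W → W') : Prop where
  root : g t.root = t'.root
  par : ∀ x, g (t.par x) = t'.par (g x)
  depth : ∀ x, t'.depth (g x) = t.depth x
  color : ∀ x, c' (g x) = c x

lemma IsHom.par_iterate {t : RTree W} {t' : RTree W'} {c : W → C} {c' : W' → C} {g : W → W'}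
    (hg : IsHom t t' c c' g) (i : ℕ) (x : W) : g (t.par^[i] x) = t'.par^[i] (g x) := by
  induction i generalizing x with
  | zero => rfl
  | succ i ih => rw [Function.iterate_succ_apply, Function.iterate_succ_apply, ih, hg.par]

lemma IsHom.child {t : RTree W} {t' : RTree W'} {c : W → C} {c' : W' → C} {g : W → W'}
    (hg : IsHom t t' c c' g) {x y : W} (h : t.Child x y) : t'.Child (g x) (g y) := by
  refine ⟨by rw [← hg.par, h.1], fun h0 => h.2 ?_⟩
  rw [← t.depth_eq_zero, ← hg.depth, h0, depth_root]

lemma exists_child_map {t : RTree W} {t' : RTree W'} {N N' : ℕ → ℕ} {c : W → C} {c' : W' → C}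
    [Finite C] {K : Type} [Finite K] {h : ℕ} (hN : N h * Nat.card K < N' h) (σ : W → K)
    {w : W} {w' : W'} (e : t.ty N' c (h + 1) w = t'.ty N' c' (h + 1) w') :
    ∃ f : W' → W, (∀ a, t'.Child w' a → t.Child w (f a) ∧ t.ty N' c h (f a) = t'.ty N' c' h a) ∧
      ∀ Z : Set K, CapEq (N h) {a | t'.Child w' a ∧ σ (f a) ∈ Z}.encard
        {a | t.Child w a ∧ σ a ∈ Z}.encard := by
  have : Nonempty W := ⟨w⟩
  have e := (ty_succ_eq_iff.1 e).2
  choose g hg hgk using fun τ => (e τ).exists_map hN σ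
  have hf : ∀ a, t'.Child w' a →
      t.Child w (g (t'.ty N' c' h a) a) ∧ t.ty N' c h (g (t'.ty N' c' h a) a) = t'.ty N' c' h a :=
    fun a ha => hg (t'.ty N' c' h a) a ⟨ha, rfl⟩
  refine ⟨fun a => g (t'.ty N' c' h a) a, hf, fun Z => ?_⟩
  refine CapEq.of_forall_fiber (K := TreeTy N' C h × K)
    (σ := fun a => (t'.ty N' c' h a, σ (g (t'.ty N' c' h a) a)))
    (τ := fun a => (t.ty N' c h a, σ a)) ?_
  rintro ⟨τ, k⟩
  by_cases hk : k ∈ Z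
  · convert hgk τ k using 2
    · ext a
      simp only [Set.mem_ofPred_eq, Prod.mk.injEq]
      constructor
      · rintro ⟨⟨h1, h2⟩, rfl, rfl⟩; exact ⟨⟨h1, rfl⟩, rfl⟩
      · rintro ⟨⟨h1, rfl⟩, rfl⟩; exact ⟨⟨h1, hk⟩, rfl, rfl⟩
    · ext a
      simp only [Set.mem_ofPred_eq, Prod.mk.injEq]
      constructor
      · rintro ⟨⟨h1, h2⟩, rfl, rfl⟩; exact ⟨⟨h1, rfl⟩, rfl⟩
      · rintro ⟨⟨h1, rfl⟩, rfl⟩; exact ⟨⟨h1, hk⟩, rfl, rfl⟩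
  · convert CapEq.refl (N h) 0 using 1
    · rw [Set.encard_eq_zero, Set.eq_empty_iff_forall_notMem]
      rintro a ⟨⟨h1, h2⟩, h3⟩
      simp only [Prod.mk.injEq] at h3
      exact hk (h3.2 ▸ h2)
    · rw [Set.encard_eq_zero, Set.eq_empty_iff_forall_notMem]
      rintro a ⟨⟨h1, h2⟩, h3⟩
      simp only [Prod.mk.injEq] at h3
      exact hk (h3.2 ▸ h2)

/-- Trees of the same type admit a map preserving the number of children of each colour,
up to a threshold. -/
lemma exists_isHom {t : RTree W} {t' : RTree W'} {N N' : ℕ → ℕ} {c : W → C} {c' : W' → C}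
    [Finite C] {K : ℕ → Type} [∀ h, Finite (K h)] (hN : ∀ h, N h * Nat.card (K h) < N' h)
    (σ : ∀ h, W → K h) {d : ℕ} (hd : ∀ x, t'.depth x ≤ d)
    (e : t.ty N' c d t.root = t'.ty N' c' d t'.root) :
    ∃ g : W' → W, IsHom t' t c' c g ∧ ∀ w h, t'.depth w + (h + 1) = d → ∀ Z : Set (K h),
      CapEq (N h) {a | t'.Child w a ∧ σ h (g a) ∈ Z}.encard
        {a | t.Child (g w) a ∧ σ h a ∈ Z}.encard := by
  classical
  have hsel : ∀ h w w', ∃ f : W' → W, t.ty N' c (h + 1) w = t'.ty N' c' (h + 1) w' →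
      (∀ a, t'.Child w' a → t.Child w (f a) ∧ t.ty N' c h (f a) = t'.ty N' c' h a) ∧
      ∀ Z : Set (K h), CapEq (N h) {a | t'.Child w' a ∧ σ h (f a) ∈ Z}.encard
        {a | t.Child w a ∧ σ h a ∈ Z}.encard := by
    intro h w w'
    by_cases e : t.ty N' c (h + 1) w = t'.ty N' c' (h + 1) w'
    · obtain ⟨f, hf⟩ := exists_child_map (hN h) (σ h) e
      exact ⟨f, fun _ => hf⟩
    · exact ⟨fun _ => w, fun h => absurd h e⟩
  choose sel hsel using hsel
  let gk : ℕ → W' → W := fun k => Nat.rec (fun _ => t.root)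
    (fun k g x => sel (d - (k + 1)) (g (t'.par x)) (t'.par x) x) k
  let g : W' → W := fun x => gk (t'.depth x) x
  have g0 : g t'.root = t.root := by simp only [g, depth_root]; rfl
  have gs : ∀ x, x ≠ t'.root →
      g x = sel (d - t'.depth x) (g (t'.par x)) (t'.par x) x := by
    intro x hx
    obtain ⟨k, hk⟩ := Nat.exists_eq_succ_of_ne_zero (mt (t'.depth_eq_zero x).1 hx)
    have hp : t'.depth (t'.par x) = k := by rw [t'.depth_par, hk]; rfl
    simp only [g, hk, hp]
    rfl
  have main : ∀ k x, t'.depth x = k →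
      t.ty N' c (d - k) (g x) = t'.ty N' c' (d - k) x ∧ t.depth (g x) = k := by
    intro k
    induction k with
    | zero =>
      intro x hx
      rw [t'.depth_eq_zero] at hx
      subst hx
      rw [g0]
      exact ⟨e, t.depth_root⟩
    | succ k ih =>
      intro x hx
      have hx0 : x ≠ t'.root := fun h => by
        rw [h, depth_root] at hx; omega
      have hp : t'.depth (t'.par x) = k := by rw [t'.depth_par, hx]; rfl
      obtain ⟨h1, h2⟩ := ih _ hp
      have hdk : d - k = d - (k + 1) + 1 := by have := hd x; omega
      rw [hdk] at h1
      have := (hsel _ _ _ h1).1 x ⟨rfl, hx0⟩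
      rw [gs x hx0, hx]
      exact ⟨this.2, by rw [this.1.depth, h2]⟩
  have hpar : ∀ x, x ≠ t'.root → t.Child (g (t'.par x)) (g x) := by
    intro x hx0
    have h0 := mt (t'.depth_eq_zero x).1 hx0
    have hp := t'.depth_par x
    have h1 := (main _ _ hp).1
    have hdk : d - (t'.depth x - 1) = d - t'.depth x + 1 := by have := hd x; omega
    rw [hdk] at h1
    have := (hsel _ _ _ h1).1 x ⟨rfl, hx0⟩
    rw [gs x hx0]
    exact this.1
  refine ⟨g, ⟨g0, ?_, fun x => (main _ x rfl).2, ?_⟩, ?_⟩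
  · intro x
    by_cases hx : x = t'.root
    · subst hx; rw [t'.par_root, g0, t.par_root]
    · exact (hpar x hx).1.symm
  · intro x
    have := (main _ x rfl).1
    rw [← color_ty t N' c (d - t'.depth x), this, color_ty]
  · intro w h hw Z
    have h1 := (main _ w rfl).1
    have hdk : d - t'.depth w = h + 1 := by omega
    rw [hdk] at h1
    convert (hsel _ _ _ h1).2 Z using 4 with a
    refine and_congr_right fun ha => ?_
    rw [gs a ha.2, ha.1, ha.depth]
    have : d - (t'.depth w + 1) = h := by omega
    rw [this]

/-- Thresholds sufficient for one move in the game with thresholds `N`. -/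
noncomputable def up (C : Type) (N : ℕ → ℕ) (h : ℕ) : ℕ :=
  N h * Nat.card (TreeTy N (C × Prop) h × Prop) + 2

/-- The colouring extending `c` by the indicator of `X`. -/
def extend (c : W → C) (X : Set W) (w : W) : C × Prop := (c w, w ∈ X)

lemma exists_move {t : RTree W} {t' : RTree W'} {N : ℕ → ℕ} {c : W → C} {c' : W' → C}
    [Finite C] {d : ℕ} (hd : ∀ x, t'.depth x ≤ d)
    (e : t.ty (up C N) c d t.root = t'.ty (up C N) c' d t'.root) (X P : Set W) :
    ∃ g : W' → W, IsHom t' t c' c g ∧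
      t.ty N (extend c X) d t.root = t'.ty N (extend c' (g ⁻¹' X)) d t'.root ∧
      ∀ w h, t'.depth w + (h + 1) = d →
      CapEq (N h) {a | t'.Child w a ∧ g a ∈ P}.encard {a | t.Child (g w) a ∧ a ∈ P}.encard := by
  obtain ⟨g, hg, H⟩ := exists_isHom (N := N) (K := fun h => TreeTy N (C × Prop) h × Prop)
    (fun h => by rw [up]; omega) (fun h w => (t.ty N (extend c X) h w, w ∈ P)) hd e
  have key : ∀ h w, t'.depth w + h = d →
      t.ty N (extend c X) h (g w) = t'.ty N (extend c' (g ⁻¹' X)) h w := by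
    intro h
    induction h with
    | zero => intro w _; exact Prod.ext (hg.color w) rfl
    | succ h ih =>
      intro w hw
      refine ty_succ_eq_iff.2 ⟨Prod.ext (hg.color w) rfl, fun τ => ?_⟩
      refine CapEq.symm ?_
      convert H w h hw {x | x.1 = τ} using 4 with a
      swap
      · rfl
      refine and_congr_right fun ha => ?_
      rw [← ih a (by rw [ha.depth]; omega)]
      rfl
  refine ⟨g, hg, ?_, fun w h hw => ?_⟩
  · rw [← key d t'.root (by rw [t'.depth_root, zero_add]), hg.root]
  · exact H w h hw {x | x.2}

lemma exists_move_singleton {t : RTree W} {t' : RTree W'} {N : ℕ → ℕ} {c : W → C} {c' : W' → C}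
    [Finite C] {d : ℕ} (hN : ∀ h, 2 ≤ N h) (hd : ∀ x, t.depth x ≤ d) (hd' : ∀ x, t'.depth x ≤ d)
    (e : t.ty (up C N) c d t.root = t'.ty (up C N) c' d t'.root) (x : W) :
    ∃ x' : W', t'.depth x' = t.depth x ∧
      t.ty N (extend c {x}) d t.root = t'.ty N (extend c' {x'}) d t'.root := by
  obtain ⟨g, hg, hty, H⟩ := exists_move hd' e {x} {y | ∃ i, t.par^[i] x = y}
  have hP : ∀ y ∈ {y | ∃ i, t.par^[i] x = y}, ∀ z ∈ {y | ∃ i, t.par^[i] x = y},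
      t.depth y = t.depth z → y = z := by
    rintro _ ⟨i, rfl⟩ _ ⟨j, rfl⟩ h
    rw [depth_par_iterate, depth_par_iterate] at h
    by_cases hij : i = j
    · rw [hij]
    · have h1 : t.depth (t.par^[i] x) = 0 := by rw [depth_par_iterate]; omega
      have h2 : t.depth (t.par^[j] x) = 0 := by rw [depth_par_iterate]; omega
      rw [(t.depth_eq_zero _).1 h1, (t.depth_eq_zero _).1 h2]
  have key : ∀ k, ∀ y ∈ {y | ∃ i, t.par^[i] x = y}, t.depth y = k → ∃! y', g y' = y := by
    intro k
    induction k with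
    | zero =>
      intro y _ hy
      rw [t.depth_eq_zero] at hy
      subst hy
      refine ⟨t'.root, hg.root, fun z hz => ?_⟩
      rw [← t'.depth_eq_zero, ← hg.depth, hz, depth_root]
    | succ k ih =>
      intro y hyP hy
      have hy0 : y ≠ t.root := fun h => by rw [h, depth_root] at hy; omega
      have hpP : t.par y ∈ {y | ∃ i, t.par^[i] x = y} := by
        obtain ⟨i, rfl⟩ := hyP
        exact ⟨i + 1, by rw [Function.iterate_succ_apply']⟩
      obtain ⟨w', hw', hw'u⟩ := ih _ hpP (by rw [t.depth_par, hy]; rfl)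
      dsimp only at hw' hw'u
      have hdw : t'.depth w' = k := by rw [← hg.depth, hw', t.depth_par, hy]; rfl
      have hdy := hd y
      have hc := H w' (d - (k + 1)) (by omega)
      have h1 : {a | t.Child (g w') a ∧ a ∈ {y | ∃ i, t.par^[i] x = y}} = {y} := by
        ext a
        simp only [Set.mem_ofPred_eq, Set.mem_singleton_iff]
        constructor
        · rintro ⟨h1, h2⟩
          refine hP _ h2 _ hyP ?_
          rw [h1.depth, hg.depth, hdw, hy]
        · rintro rfl
          exact ⟨⟨hw'.symm, hy0⟩, hyP⟩
      rw [h1, Set.encard_singleton] at hc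
      have h2 : {a | t'.Child w' a ∧ g a ∈ {y | ∃ i, t.par^[i] x = y}}.encard = 1 := by
        rcases hc.eq_or_le with h | h
        · exact h.1
        · exfalso
          have h3 : N (d - (k + 1)) ≤ 1 := by exact_mod_cast h.2
          have := hN (d - (k + 1))
          omega
      obtain ⟨a, ha⟩ := Set.encard_eq_one.1 h2
      have haS : a ∈ {a | t'.Child w' a ∧ g a ∈ {y | ∃ i, t.par^[i] x = y}} := by rw [ha]; rfl
      refine ⟨a, hP _ haS.2 _ hyP ?_, fun z hz => ?_⟩
      · rw [hg.depth, haS.1.depth, hdw, hy]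
      · have : z ∈ {a | t'.Child w' a ∧ g a ∈ {y | ∃ i, t.par^[i] x = y}} := by
          refine ⟨⟨hw'u _ (by rw [hg.par, hz]), ?_⟩, ?_⟩
          · rintro rfl
            exact hy0 (hz ▸ hg.root)
          · rw [hz]; exact hyP
        rw [ha] at this
        exact this
  obtain ⟨x', hx', hx'u⟩ := key _ x ⟨0, rfl⟩ rfl
  refine ⟨x', by rw [← hg.depth, hx'], ?_⟩
  have : g ⁻¹' {x} = {x'} := by
    ext z
    exact ⟨fun hz => hx'u z hz, fun hz => by rw [Set.mem_singleton_iff.1 hz]; exact hx'⟩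
  rw [← this, hty]

end RTree

namespace RTree

variable {W W' C : Type}

/-- Thresholds sufficient for preserving formulas of quantifier rank `m` over trees coloured
with colours from `C`. -/
noncomputable def thr : ℕ → Type → ℕ → ℕ
  | 0, _ => fun _ => 2
  | m + 1, C => up C (thr m (C × Prop))

lemma two_le_thr (m : ℕ) (C : Type) (h : ℕ) : 2 ≤ thr m C h := by
  cases m with
  | zero => exact le_rfl
  | succ m => rw [thr, up]; omega

/-- A structure lives on those nodes of a tree whose depth lies in `J`. -/
structure LivesOn {ι : Type} (t : RTree W) (M : MStr ι) (e : M.V → W) (J : Set ℕ) : Prop where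
  inj : Function.Injective e
  range : ∀ w, (∃ x, e x = w) ↔ t.depth w ∈ J

lemma exists_isHom_of_ty_eq {t : RTree W} {t' : RTree W'} {c : W → C} {c' : W' → C} [Finite C]
    {N : ℕ → ℕ} (hN : ∀ h, 2 ≤ N h) {d : ℕ} (hd : ∀ x, t'.depth x ≤ d)
    (h : t.ty N c d t.root = t'.ty N c' d t'.root) : ∃ g : W' → W, IsHom t' t c' c g := by
  obtain ⟨g, hg, -⟩ := exists_isHom (N := fun _ => 0) (K := fun _ => Unit)
    (fun h => by have := hN h; omega) (fun _ _ => ()) hd h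
  exact ⟨g, hg⟩

lemma IsHom.mono {D : Type} {t : RTree W} {t' : RTree W'} {c : W → C} {c' : W' → C}
    {b : W → D} {b' : W' → D} {g : W → W'} (hg : IsHom t t' c c' g)
    (hb : ∀ w w', c w = c' w' → b w = b' w') : IsHom t t' b b' g :=
  ⟨hg.root, hg.par, hg.depth, fun x => (hb _ _ (hg.color x).symm).symm⟩

/-- MSO formulas over structures living on coloured trees, with atomic relations preserved by
pairs of opposite maps of coloured trees, are preserved by equality of tree types. -/
theorem realize_iff {ι B : Type} {t : RTree W} {t' : RTree W'} {d : ℕ}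
    (hd : ∀ x, t.depth x ≤ d) (hd' : ∀ x, t'.depth x ≤ d)
    {M M' : MStr ι} {e : M.V → W} {e' : M'.V → W'} {J : Set ℕ}
    (he : t.LivesOn M e J) (he' : t'.LivesOn M' e' J) {b : W → B} {b' : W' → B}
    (hE : ∀ x y x' y',
      (∃ g, IsHom t t' b b' g ∧ g (e x) = e' x' ∧ g (e y) = e' y') →
      (∃ g, IsHom t' t b' b g ∧ g (e' x') = e x ∧ g (e' y') = e y) → (M.E x y ↔ M'.E x' y'))
    (hP : ∀ a x x', (∃ g, IsHom t t' b b' g ∧ g (e x) = e' x') →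
      (∃ g, IsHom t' t b' b g ∧ g (e' x') = e x) → (M.P a x ↔ M'.P a x'))
    (φ : MSOForm ι) : ∀ (m : ℕ) (C : Type) [Finite C] (c : W → C) (c' : W' → C)
    (v : ℕ → M.V) (v' : ℕ → M'.V) (s : ℕ → Set M.V) (s' : ℕ → Set M'.V), φ.qr ≤ m →
    t.ty (thr m C) c d t.root = t'.ty (thr m C) c' d t'.root →
    (∀ w w', c w = c' w' → b w = b' w') →
    (∀ i ∈ φ.freeFO, ∀ x x', c (e x) = c' (e' x') → (x = v i ↔ x' = v' i)) →
    (∀ i ∈ φ.freeSO, ∀ x x', c (e x) = c' (e' x') → (x ∈ s i ↔ x' ∈ s' i)) →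
    (M.Realize φ v s ↔ M'.Realize φ v' s') := by
  have homs : ∀ (m : ℕ) (C : Type) [Finite C] (c : W → C) (c' : W' → C)
      (v : ℕ → M.V) (v' : ℕ → M'.V) (F : Finset ℕ),
      t.ty (thr m C) c d t.root = t'.ty (thr m C) c' d t'.root →
      (∀ i ∈ F, ∀ x x', c (e x) = c' (e' x') → (x = v i ↔ x' = v' i)) →
      (∃ g, IsHom t t' c c' g ∧ ∀ i ∈ F, g (e (v i)) = e' (v' i)) ∧
      (∃ g, IsHom t' t c' c g ∧ ∀ i ∈ F, g (e' (v' i)) = e (v i)) := by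
    intro m C _ c c' v v' F hty hF
    obtain ⟨g, hg⟩ := exists_isHom_of_ty_eq (two_le_thr m C) hd hty.symm
    obtain ⟨k, hk⟩ := exists_isHom_of_ty_eq (two_le_thr m C) hd' hty
    refine ⟨⟨g, hg, fun i hi => ?_⟩, ⟨k, hk, fun i hi => ?_⟩⟩
    · obtain ⟨x', hx'⟩ := (he'.range (g (e (v i)))).2
        (by rw [hg.depth]; exact (he.range _).1 ⟨_, rfl⟩)
      rw [← hx', (hF i hi (v i) x' (by rw [hx', hg.color])).1 rfl]
    · obtain ⟨x, hx⟩ := (he.range (k (e' (v' i)))).2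
        (by rw [hk.depth]; exact (he'.range _).1 ⟨_, rfl⟩)
      rw [← hx, (hF i hi x (v' i) (by rw [hx, hk.color])).2 rfl]
  induction φ with
  | fal => intros; exact Iff.rfl
  | eq i j =>
    intro m C _ c c' v v' s s' _ hty _ hFO _
    obtain ⟨⟨g, hg, hgF⟩, ⟨k, hk, hkF⟩⟩ := homs m C c c' v v' _ hty hFO
    have hi : i ∈ (MSOForm.eq i j : MSOForm ι).freeFO := by simp [MSOForm.freeFO]
    have hj : j ∈ (MSOForm.eq i j : MSOForm ι).freeFO := by simp [MSOForm.freeFO]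
    constructor
    · intro h
      have h : v i = v j := h
      exact he'.inj (by rw [← hgF i hi, ← hgF j hj, h])
    · intro h
      have h : v' i = v' j := h
      exact he.inj (by rw [← hkF i hi, ← hkF j hj, h])
  | edge i j =>
    intro m C _ c c' v v' s s' _ hty hb hFO _
    obtain ⟨⟨g, hg, hgF⟩, ⟨k, hk, hkF⟩⟩ := homs m C c c' v v' _ hty hFO
    have hi : i ∈ (MSOForm.edge i j : MSOForm ι).freeFO := by simp [MSOForm.freeFO]
    have hj : j ∈ (MSOForm.edge i j : MSOForm ι).freeFO := by simp [MSOForm.freeFO]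
    exact hE _ _ _ _ ⟨g, hg.mono hb, hgF i hi, hgF j hj⟩
      ⟨k, hk.mono fun w w' h => (hb w' w h.symm).symm, hkF i hi, hkF j hj⟩
  | pred a i =>
    intro m C _ c c' v v' s s' _ hty hb hFO _
    obtain ⟨⟨g, hg, hgF⟩, ⟨k, hk, hkF⟩⟩ := homs m C c c' v v' _ hty hFO
    have hi : i ∈ (MSOForm.pred a i : MSOForm ι).freeFO := by simp [MSOForm.freeFO]
    exact hP _ _ _ ⟨g, hg.mono hb, hgF i hi⟩
      ⟨k, hk.mono fun w w' h => (hb w' w h.symm).symm, hkF i hi⟩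
  | mem i X =>
    intro m C _ c c' v v' s s' _ hty hb hFO hSO
    obtain ⟨⟨g, hg, hgF⟩, -⟩ := homs m C c c' v v' _ hty hFO
    have hi : i ∈ (MSOForm.mem i X : MSOForm ι).freeFO := by simp [MSOForm.freeFO]
    have hX : X ∈ (MSOForm.mem i X : MSOForm ι).freeSO := by simp [MSOForm.freeSO]
    exact hSO X hX _ _ (by rw [← hgF i hi, hg.color])
  | imp φ ψ ihφ ihψ =>
    intro m C _ c c' v v' s s' hm hty hb hFO hSO
    have hm : max φ.qr ψ.qr ≤ m := hm
    refine imp_congr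
      (ihφ m C c c' v v' s s' (by omega) hty hb (fun i hi => hFO i ?_) (fun i hi => hSO i ?_))
      (ihψ m C c c' v v' s s' (by omega) hty hb (fun i hi => hFO i ?_) (fun i hi => hSO i ?_)) <;>
    simp [MSOForm.freeFO, MSOForm.freeSO, hi]
  | exFO n φ ih =>
    intro m C _ c c' v v' s s' hm hty hb hFO hSO
    obtain ⟨m, rfl⟩ : ∃ k, m = k + 1 := ⟨m - 1, by simp only [MSOForm.qr] at hm; omega⟩
    have hm : φ.qr ≤ m := by simp only [MSOForm.qr] at hm; omega
    have step : ∀ x₀ x₀', t.ty (thr m (C × Prop)) (extend c {e x₀}) d t.root =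
        t'.ty (thr m (C × Prop)) (extend c' {e' x₀'}) d t'.root →
        (M.Realize φ (Function.update v n x₀) s ↔ M'.Realize φ (Function.update v' n x₀') s') := by
      intro x₀ x₀' h
      refine ih m (C × Prop) _ _ _ _ s s' hm h ?_ ?_ ?_
      · exact fun w w' h => hb w w' (Prod.ext_iff.1 h).1
      · intro i hi x x' hx
        obtain ⟨hx1, hx2⟩ := Prod.ext_iff.1 hx
        by_cases hin : i = n
        · subst hin
          simp only [extend, Set.mem_singleton_iff, eq_iff_iff] at hx2
          simpa [he.inj.eq_iff, he'.inj.eq_iff] using hx2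
        · simpa [Function.update_of_ne hin] using
            hFO i (by simp [MSOForm.freeFO, hi, hin]) x x' hx1
      · intro i hi x x' hx
        exact hSO i hi x x' (Prod.ext_iff.1 hx).1
    constructor
    · rintro ⟨x₀, h⟩
      obtain ⟨w, hw, hw'⟩ := exists_move_singleton (two_le_thr m _) hd hd' hty (e x₀)
      obtain ⟨x₀', rfl⟩ := (he'.range w).2 (by rw [hw]; exact (he.range _).1 ⟨_, rfl⟩)
      exact ⟨x₀', (step _ _ hw').1 h⟩
    · rintro ⟨x₀', h⟩
      obtain ⟨w, hw, hw'⟩ := exists_move_singleton (two_le_thr m _) hd' hd hty.symm (e' x₀')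
      obtain ⟨x₀, rfl⟩ := (he.range w).2 (by rw [hw]; exact (he'.range _).1 ⟨_, rfl⟩)
      exact ⟨x₀, (step _ _ hw'.symm).2 h⟩
  | exSO n φ ih =>
    intro m C _ c c' v v' s s' hm hty hb hFO hSO
    obtain ⟨m, rfl⟩ : ∃ k, m = k + 1 := ⟨m - 1, by simp only [MSOForm.qr] at hm; omega⟩
    have hm : φ.qr ≤ m := by simp only [MSOForm.qr] at hm; omega
    have step : ∀ X X', t.ty (thr m (C × Prop)) (extend c X) d t.root =
        t'.ty (thr m (C × Prop)) (extend c' X') d t'.root →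
        (M.Realize φ v (Function.update s n (e ⁻¹' X)) ↔
          M'.Realize φ v' (Function.update s' n (e' ⁻¹' X'))) := by
      intro X X' h
      refine ih m (C × Prop) _ _ v v' _ _ hm h ?_ ?_ ?_
      · exact fun w w' h => hb w w' (Prod.ext_iff.1 h).1
      · intro i hi x x' hx
        exact hFO i hi x x' (Prod.ext_iff.1 hx).1
      · intro i hi x x' hx
        obtain ⟨hx1, hx2⟩ := Prod.ext_iff.1 hx
        by_cases hin : i = n
        · subst hin
          simpa [extend] using hx2
        · simpa [Function.update_of_ne hin] using
            hSO i (by simp [MSOForm.freeSO, hi, hin]) x x' hx1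
    constructor
    · rintro ⟨A, h⟩
      obtain ⟨g, -, hg, -⟩ := exists_move hd' hty (e '' A) ∅
      refine ⟨_, (step _ _ hg).1 ?_⟩
      rwa [Set.preimage_image_eq _ he.inj]
    · rintro ⟨A, h⟩
      obtain ⟨g, -, hg, -⟩ := exists_move hd hty.symm (e' '' A) ∅
      refine ⟨_, (step _ _ hg.symm).2 ?_⟩
      rwa [Set.preimage_image_eq _ he'.inj]

/-- Version of `RTree.realize_iff` for sentences. -/
theorem sat_iff {ι B : Type} [Finite B] {t : RTree W} {t' : RTree W'} {d : ℕ}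
    (hd : ∀ x, t.depth x ≤ d) (hd' : ∀ x, t'.depth x ≤ d)
    {M M' : MStr ι} [Nonempty M.V] [Nonempty M'.V] {e : M.V → W} {e' : M'.V → W'} {J : Set ℕ}
    (he : t.LivesOn M e J) (he' : t'.LivesOn M' e' J) {b : W → B} {b' : W' → B}
    (hE : ∀ x y x' y',
      (∃ g, IsHom t t' b b' g ∧ g (e x) = e' x' ∧ g (e y) = e' y') →
      (∃ g, IsHom t' t b' b g ∧ g (e' x') = e x ∧ g (e' y') = e y) → (M.E x y ↔ M'.E x' y'))
    (hP : ∀ a x x', (∃ g, IsHom t t' b b' g ∧ g (e x) = e' x') →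
      (∃ g, IsHom t' t b' b g ∧ g (e' x') = e x) → (M.P a x ↔ M'.P a x'))
    {φ : MSOForm ι} (hφ : φ.IsSentence)
    (hty : t.ty (thr φ.qr B) b d t.root = t'.ty (thr φ.qr B) b' d t'.root) :
    M.Sat φ ↔ M'.Sat φ := by
  have key : ∀ v s v' s', M.Realize φ v s ↔ M'.Realize φ v' s' := fun v s v' s' =>
    realize_iff hd hd' he he' hE hP φ φ.qr B b b' v v' s s' le_rfl hty (fun _ _ h => h)
      (by simp [hφ.1]) (by simp [hφ.2])
  exact ⟨fun h v' s' => (key (fun _ => Classical.arbitrary _) (fun _ => ∅) v' s').1 (h _ _),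
    fun h v s => (key v s (fun _ => Classical.arbitrary _) (fun _ => ∅)).2 (h _ _)⟩

end RTree

lemma natCast_le_encard_iff {α : Type} {A : Set α} {j : ℕ} :
    (j : ℕ∞) ≤ A.encard ↔ ∃ f : Fin j → α, Function.Injective f ∧ ∀ i, f i ∈ A := by
  constructor
  · intro h
    obtain ⟨D, hDA, hD⟩ := Set.exists_subset_encard_eq h
    have hfin : Finite D := (Set.finite_of_encard_eq_coe hD).to_subtype
    have hcard : Nat.card D = j := by
      rw [Nat.card_coe_set_eq, Set.ncard, hD]; rfl
    let f := (Finite.equivFinOfCardEq hcard).symm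
    exact ⟨fun i => (f i).1, fun x y h => f.injective (Subtype.ext h), fun i => hDA (f i).2⟩
  · rintro ⟨f, hf, hA⟩
    have : (Set.range f).encard = j := by
      rw [← Set.image_univ, hf.encard_image, Set.encard_univ]
      simp
    rw [← this]
    exact Set.encard_le_encard (Set.range_subset_iff.2 hA)

lemma Ultrafilter.exists_eventually_eq {ι β : Type} [Finite β] (U : Ultrafilter ι) (f : ι → β) :
    ∃ b, ∀ᶠ n in (U : Filter ι), f n = b := by
  obtain ⟨b, hb⟩ := (U.map f).eq_pure_of_finite
  refine ⟨b, ?_⟩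
  have : {b} ∈ U.map f := by rw [hb]; exact Ultrafilter.mem_pure.2 rfl
  exact this

/-- A sequence of points generates a countable substructure of an ultraproduct equipped with
countably many unary functions. -/
lemma Ultrafilter.exists_countable_hull {ι I : Type} [Countable I] (U : Ultrafilter ι)
    (W : ι → Type) (F : I → ∀ n, W n → W n) (r : ∀ n, W n) :
    ∃ (W' : Type) (_ : Countable W') (rep : W' → ∀ n, W n),
      (∀ x y, (∀ᶠ n in (U : Filter ι), rep x n = rep y n) → x = y) ∧
      (∃ x, ∀ᶠ n in (U : Filter ι), rep x n = r n) ∧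
      ∀ i x, ∃ y, ∀ᶠ n in (U : Filter ι), rep y n = F i n (rep x n) := by
  let ev : List I → ∀ n, W n := fun l n => l.foldr (fun i w => F i n w) (r n)
  let S : Setoid (List I) :=
    { r := fun l l' => ∀ᶠ n in (U : Filter ι), ev l n = ev l' n
      iseqv := ⟨fun l => .of_forall fun n => rfl, fun h => h.mono fun n h => h.symm,
        fun h h' => by filter_upwards [h, h'] with n h h' using h.trans h'⟩ }
  have hout : ∀ l, ∀ᶠ n in (U : Filter ι), ev (Quotient.mk S l).out n = ev l n :=
    fun l => Quotient.mk_out (s := S) l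
  refine ⟨Quotient S, inferInstance, fun x => ev x.out, fun x y h => ?_, ⟨Quotient.mk S [], hout []⟩,
    fun i x => ⟨Quotient.mk S (i :: x.out), hout _⟩⟩
  rw [← x.out_eq, ← y.out_eq]
  exact Quotient.sound h

namespace RTree

/-- Every family of coloured trees of bounded height has a countable limit along an ultrafilter,
whose types are the limits of the types in the family. -/
theorem exists_limit {ι C : Type} [Finite C] (U : Ultrafilter ι) {W : ι → Type}
    (t : ∀ n, RTree (W n)) (c : ∀ n, W n → C) {d : ℕ} (hd : ∀ n x, (t n).depth x ≤ d)
    (N : ℕ → ℕ → ℕ) :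
    ∃ (W' : Type) (_ : Countable W') (t' : RTree W') (c' : W' → C),
      (∀ m h, ∀ᶠ n in (U : Filter ι),
        (t n).ty (N m) (c n) h (t n).root = t'.ty (N m) c' h t'.root) ∧
      ∀ x, ∀ᶠ n in (U : Filter ι), ∃ y, (t n).depth y = t'.depth x ∧ c n y = c' x ∧
        ((∃ a, (t n).Child y a) → ∃ a, t'.Child x a) := by
  classical
  have hchild : ∀ n w, ∃ a, (∃ a, (t n).Child w a) → (t n).Child w a := by
    intro n w
    by_cases h : ∃ a, (t n).Child w a
    · exact ⟨h.choose, fun _ => h.choose_spec⟩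
    · exact ⟨w, fun h' => absurd h' h⟩
  choose ch hch using hchild
  have hwit : ∀ m h (τ : TreeTy (N m) C h) (j : ℕ) n w, ∃ f : Fin j → W n,
      ((j : ℕ∞) ≤ {a | (t n).Child w a ∧ (t n).ty (N m) (c n) h a = τ}.encard →
        Function.Injective f ∧ ∀ i, f i ∈ {a | (t n).Child w a ∧ (t n).ty (N m) (c n) h a = τ}) := by
    intro m h τ j n w
    by_cases H : (j : ℕ∞) ≤ {a | (t n).Child w a ∧ (t n).ty (N m) (c n) h a = τ}.encard
    · obtain ⟨f, hf⟩ := natCast_le_encard_iff.1 H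
      exact ⟨f, fun _ => hf⟩
    · exact ⟨fun _ => w, fun h => absurd h H⟩
  choose wit hwit using hwit
  let I := Option (Option (Σ p : ℕ × ℕ × ℕ, TreeTy (N p.1) C p.2.1 × Fin p.2.2))
  let F : I → ∀ n, W n → W n := fun i n w =>
    match i with
    | none => (t n).par w
    | some none => ch n w
    | some (some ⟨p, τ, i⟩) => wit p.1 p.2.1 τ p.2.2 n w i
  obtain ⟨W', hW', rep, hinj, ⟨r, hr⟩, hF⟩ := U.exists_countable_hull W F fun n => (t n).root
  have hpar := hF none
  choose par hpar using hpar
  have hdep : ∀ x, ∃ k, ∀ᶠ n in (U : Filter ι), (t n).depth (rep x n) = k := by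
    intro x
    obtain ⟨k, hk⟩ := U.exists_eventually_eq
      fun n => (⟨(t n).depth (rep x n), Nat.lt_succ_of_le (hd n _)⟩ : Fin (d + 1))
    exact ⟨k, hk.mono fun n h => congrArg Fin.val h⟩
  choose depth hdep using hdep
  choose c' hc' using fun x => U.exists_eventually_eq fun n => c n (rep x n)
  let t' : RTree W' :=
    { root := r
      depth := depth
      par := par
      depth_eq_zero := by
        intro x
        constructor
        · intro h
          refine hinj _ _ ?_
          filter_upwards [hdep x, hr] with n h1 h2
          rw [h2, ← (t n).depth_eq_zero, h1, h]
        · rintro rfl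
          obtain ⟨n, h1, h2⟩ := ((hdep x).and hr).exists
          rw [← h1, h2, depth_root]
      depth_par := by
        intro x
        obtain ⟨n, h1, h2, h3⟩ := ((hdep x).and ((hdep (par x)).and (hpar x))).exists
        rw [← h1, ← h2, h3]
        exact (t n).depth_par _ }
  have child_of : ∀ x a, (∀ᶠ n in (U : Filter ι), (t n).Child (rep x n) (rep a n)) →
      t'.Child x a := by
    intro x a h
    refine ⟨hinj _ _ ?_, ?_⟩
    · filter_upwards [h, hpar a] with n h1 h2
      rw [← h1.1]; exact h2
    · intro h0
      have h0 : a = r := h0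
      obtain ⟨n, h1, h2⟩ := (h.and hr).exists
      exact h1.2 (by rw [h0, h2])
  have of_child : ∀ x a, t'.Child x a →
      ∀ᶠ n in (U : Filter ι), (t n).Child (rep x n) (rep a n) := by
    intro x a h
    have h1 : par a = x := h.1
    have h2 : ∀ᶠ n in (U : Filter ι), ¬ rep a n = rep r n :=
      Ultrafilter.eventually_not.2 fun h' => h.2 (hinj _ _ h')
    filter_upwards [h2, hr, hpar a] with n h2 h3 h4
    rw [← h1, h4]
    exact ⟨rfl, fun h => h2 (by rw [h, h3])⟩
  have key : ∀ m h x, ∀ᶠ n in (U : Filter ι),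
      (t n).ty (N m) (c n) h (rep x n) = t'.ty (N m) c' h x := by
    intro m h
    induction h with
    | zero => exact hc'
    | succ h ih =>
      intro x
      have hcap : ∀ τ, ∀ j ∈ Set.Iic (N m h), ∀ᶠ n in (U : Filter ι),
          ((j : ℕ∞) ≤ {a | (t n).Child (rep x n) a ∧ (t n).ty (N m) (c n) h a = τ}.encard ↔
            (j : ℕ∞) ≤ {a | t'.Child x a ∧ t'.ty (N m) c' h a = τ}.encard) := by
        intro τ j _
        by_cases hj : (j : ℕ∞) ≤ {a | t'.Child x a ∧ t'.ty (N m) c' h a = τ}.encard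
        · obtain ⟨f, hf, hfA⟩ := natCast_le_encard_iff.1 hj
          have h1 : ∀ᶠ n in (U : Filter ι), ∀ i, (t n).Child (rep x n) (rep (f i) n) ∧
              (t n).ty (N m) (c n) h (rep (f i) n) = τ := by
            refine Filter.eventually_all.2 fun i => ?_
            filter_upwards [of_child _ _ (hfA i).1, ih (f i)] with n h1 h2
            exact ⟨h1, h2.trans (hfA i).2⟩
          have h2 : ∀ᶠ n in (U : Filter ι), ∀ i i', i ≠ i' → rep (f i) n ≠ rep (f i') n := by
            refine Filter.eventually_all.2 fun i => Filter.eventually_all.2 fun i' => ?_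
            by_cases hii : i = i'
            · exact .of_forall fun n h => absurd hii h
            · refine (Ultrafilter.eventually_not.2 fun h' => ?_).mono fun n h _ => h
              exact hii (hf (hinj _ _ h'))
          filter_upwards [h1, h2] with n h1 h2
          refine iff_of_true (natCast_le_encard_iff.2 ⟨fun i => rep (f i) n, ?_, h1⟩) hj
          intro i i' hii
          by_contra hne
          exact h2 i i' hne hii
        · refine (Ultrafilter.eventually_not.2 fun H => hj ?_).mono fun n h => iff_of_false h hj
          choose f hf using fun i : Fin j => hF (some (some ⟨(m, h, j), τ, i⟩)) x
          refine natCast_le_encard_iff.2 ⟨f, fun i i' hii => ?_, fun i => ?_⟩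
          · obtain ⟨n, h1, h2, h3⟩ := (H.and ((hf i).and (hf i'))).exists
            rw [hii] at h2
            exact (hwit m h τ j n (rep x n) h1).1 (h2.symm.trans h3)
          · have hmem : ∀ᶠ n in (U : Filter ι), (t n).Child (rep x n) (rep (f i) n) ∧
                (t n).ty (N m) (c n) h (rep (f i) n) = τ := by
              filter_upwards [H, hf i] with n h1 h2
              rw [h2]
              exact (hwit m h τ j n (rep x n) h1).2 i
            refine ⟨child_of _ _ (hmem.mono fun n h => h.1), ?_⟩
            obtain ⟨n, h1, h2⟩ := (hmem.and (ih (f i))).exists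
            rw [← h2, h1.2]
      have hall : ∀ᶠ n in (U : Filter ι), ∀ τ, ∀ j ∈ Set.Iic (N m h),
          ((j : ℕ∞) ≤ {a | (t n).Child (rep x n) a ∧ (t n).ty (N m) (c n) h a = τ}.encard ↔
            (j : ℕ∞) ≤ {a | t'.Child x a ∧ t'.ty (N m) c' h a = τ}.encard) :=
        Filter.eventually_all.2 fun τ =>
          (Filter.eventually_all_finite (Set.finite_Iic _)).2 (hcap τ)
      filter_upwards [hc' x, hall] with n h1 h2
      exact ty_succ_eq_iff.2 ⟨h1, fun τ j hj => h2 τ j hj⟩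
  refine ⟨W', hW', t', c', fun m h => ?_, fun x => ?_⟩
  · filter_upwards [key m h r, hr] with n h1 h2
    rw [← h2]; exact h1
  · by_cases hx : ∃ a, t'.Child x a
    · filter_upwards [hdep x, hc' x] with n h1 h2
      exact ⟨_, h1, h2, fun _ => hx⟩
    · have : ∀ᶠ n in (U : Filter ι), ¬ ∃ a, (t n).Child (rep x n) a := by
        refine Ultrafilter.eventually_not.2 fun H => hx ?_
        obtain ⟨y, hy⟩ := hF (some none) x
        refine ⟨y, child_of _ _ ?_⟩
        filter_upwards [H, hy] with n h1 h2
        rw [h2]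
        exact hch n _ h1
      filter_upwards [hdep x, hc' x, this] with n h1 h2 h3
      exact ⟨_, h1, h2, fun h => absurd h h3⟩

end RTree

namespace RTree

variable {W W' C : Type}

/-- The graph whose edges join the nodes of a rooted tree to their children. -/
def graph (t : RTree W) : SimpleGraph W where
  Adj x y := t.Child x y ∨ t.Child y x
  symm := ⟨fun _ _ h => h.symm⟩
  loopless := ⟨fun x h => by
    have := h.elim Child.depth Child.depth
    omega⟩

lemma par_iterate_depth (t : RTree W) (x : W) : t.par^[t.depth x] x = t.root := by
  rw [← t.depth_eq_zero, depth_par_iterate, Nat.sub_self]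

lemma exists_walk_par_iterate (t : RTree W) (x : W) (i : ℕ) :
    ∃ p : t.graph.Walk x (t.par^[i] x), p.length ≤ i := by
  induction i with
  | zero => exact ⟨.nil, le_rfl⟩
  | succ i ih =>
    obtain ⟨p, hp⟩ := ih
    rw [Function.iterate_succ_apply']
    by_cases h : t.par^[i] x = t.root
    · rw [h, t.par_root]
      exact ⟨p.copy rfl h, by rw [SimpleGraph.Walk.length_copy]; omega⟩
    · have hadj : t.graph.Adj (t.par^[i] x) (t.par (t.par^[i] x)) := Or.inr ⟨rfl, h⟩
      exact ⟨p.concat hadj, by rw [SimpleGraph.Walk.length_concat]; omega⟩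

lemma connected_graph (t : RTree W) : t.graph.Connected := by
  have hreach : ∀ x, t.graph.Reachable x t.root := fun x => by
    obtain ⟨p, -⟩ := t.exists_walk_par_iterate x (t.depth x)
    rw [par_iterate_depth] at p
    exact p.reachable
  have : Nonempty W := ⟨t.root⟩
  exact SimpleGraph.Connected.mk fun x y => (hreach x).trans (hreach y).symm

lemma isTree_graph (t : RTree W) : t.graph.IsTree := by
  classical
  refine ⟨t.connected_graph, fun v c hc => ?_⟩
  obtain ⟨x, hx, hmax⟩ := c.support.toFinset.exists_max_image t.depth
    ⟨v, List.mem_toFinset.2 c.start_mem_support⟩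
  rw [List.mem_toFinset] at hx
  have hadj : ∀ y ∈ (c.rotate x hx).support, t.graph.Adj x y → y = t.par x := by
    intro y hy hxy
    have hy' := hmax y (List.mem_toFinset.2 ((c.mem_support_rotate_iff x hx).1 hy))
    rcases hxy with h | h
    · have := h.depth; omega
    · exact h.1.symm
  have hcr : (c.rotate x hx).IsCycle := hc.rotate hx
  refine hcr.snd_ne_penultimate ((hadj _ ?_ ?_).trans (hadj _ ?_ ?_).symm)
  · exact SimpleGraph.Walk.getVert_mem_support _ _
  · exact SimpleGraph.Walk.adj_snd hcr.not_nil
  · exact SimpleGraph.Walk.getVert_mem_support _ _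
  · exact (SimpleGraph.Walk.adj_penultimate hcr.not_nil).symm

lemma exists_par_iterate_eq_of_walk {t : RTree W} {u v : W} (p : t.graph.Walk u v) :
    ∃ i j, i + j ≤ p.length ∧ t.par^[i] u = t.par^[j] v := by
  induction p with
  | nil => exact ⟨0, 0, le_rfl, rfl⟩
  | @cons u u' v h p ih =>
    obtain ⟨i, j, hij, e⟩ := ih
    simp only [SimpleGraph.Walk.length_cons]
    rcases h with h | h
    · rcases i with _ | i
      · refine ⟨0, j + 1, by omega, ?_⟩
        rw [Function.iterate_succ_apply', ← e]
        exact h.1.symm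
      · refine ⟨i, j, by omega, ?_⟩
        rw [← e, Function.iterate_succ_apply, h.1]
    · refine ⟨i + 1, j, by omega, ?_⟩
      rw [← e, Function.iterate_succ_apply, h.1]

lemma dist_graph_root (t : RTree W) (x : W) : t.graph.dist t.root x = t.depth x := by
  refine le_antisymm ?_ ?_
  · obtain ⟨p, hp⟩ := t.exists_walk_par_iterate x (t.depth x)
    rw [SimpleGraph.dist_comm]
    have := SimpleGraph.dist_le (p.copy rfl (t.par_iterate_depth x))
    rw [SimpleGraph.Walk.length_copy] at this
    omega
  · obtain ⟨p, hp⟩ := t.connected_graph.exists_walk_length_eq_dist t.root x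
    obtain ⟨i, j, hij, e⟩ := exists_par_iterate_eq_of_walk p
    have := congrArg t.depth e
    rw [depth_par_iterate, depth_par_iterate, depth_root] at this
    omega

/-- The height of the least common ancestor of two nodes of the same depth. -/
noncomputable def lca (t : RTree W) (u v : W) : ℕ := sInf {l | t.par^[l] u = t.par^[l] v}

lemma lca_comm (t : RTree W) (u v : W) : t.lca u v = t.lca v u := by
  simp only [lca, eq_comm]

lemma dist_graph_eq (t : RTree W) {u v : W} (h : t.depth u = t.depth v) :
    t.graph.dist u v = 2 * t.lca u v := by
  have hd : t.depth u ∈ {l | t.par^[l] u = t.par^[l] v} := by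
    change t.par^[_] u = t.par^[_] v
    rw [par_iterate_depth, h, par_iterate_depth]
  have hmem : t.par^[t.lca u v] u = t.par^[t.lca u v] v :=
    Nat.sInf_mem (s := {l | t.par^[l] u = t.par^[l] v}) ⟨_, hd⟩
  have hle : t.lca u v ≤ t.depth u := Nat.sInf_le hd
  refine le_antisymm ?_ ?_
  · obtain ⟨p, hp⟩ := t.exists_walk_par_iterate u (t.lca u v)
    obtain ⟨q, hq⟩ := t.exists_walk_par_iterate v (t.lca u v)
    have := SimpleGraph.dist_le ((p.copy rfl hmem).append q.reverse)
    simp only [SimpleGraph.Walk.length_append, SimpleGraph.Walk.length_copy,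
      SimpleGraph.Walk.length_reverse] at this
    omega
  · obtain ⟨p, hp⟩ := t.connected_graph.exists_walk_length_eq_dist u v
    obtain ⟨i, j, hij, e⟩ := exists_par_iterate_eq_of_walk p
    by_cases hij' : i = j
    · subst hij'
      have : t.lca u v ≤ i := Nat.sInf_le e
      omega
    · have := congrArg t.depth e
      rw [depth_par_iterate, depth_par_iterate] at this
      omega

lemma IsHom.lca_le {t : RTree W} {t' : RTree W'} {c : W → C} {c' : W' → C} {g : W → W'}
    (hg : IsHom t t' c c' g) {u v : W} (h : t.depth u = t.depth v) :
    t'.lca (g u) (g v) ≤ t.lca u v := by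
  refine Nat.sInf_le ?_
  have hmem : t.par^[t.lca u v] u = t.par^[t.lca u v] v :=
    Nat.sInf_mem (s := {l | t.par^[l] u = t.par^[l] v})
      ⟨t.depth u, by change t.par^[_] u = t.par^[_] v; rw [par_iterate_depth, h, par_iterate_depth]⟩
  change t'.par^[_] _ = t'.par^[_] _
  rw [← hg.par_iterate, ← hg.par_iterate, hmem]

/-- Every graph-theoretic tree with a chosen root comes from a rooted tree. -/
lemma exists_graph_eq {g : SimpleGraph W} (hg : g.IsTree) (r : W) :
    ∃ t : RTree W, t.root = r ∧ t.graph = g := by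
  classical
  have hpar : ∀ x, ∃ y, (x = r → y = r) ∧
      (x ≠ r → g.Adj y x ∧ g.dist r x = g.dist r y + 1) := by
    intro x
    by_cases hx : x = r
    · exact ⟨r, fun _ => rfl, fun h => absurd hx h⟩
    · obtain ⟨p, hp⟩ := hg.connected.exists_walk_length_eq_dist r x
      have hnil : ¬ p.Nil := fun h => hx h.eq.symm
      have hadj := SimpleGraph.Walk.adj_penultimate hnil
      refine ⟨p.penultimate, fun h => absurd h hx, fun _ => ⟨hadj, ?_⟩⟩
      have h1 := SimpleGraph.dist_le p.dropLast
      have h2 : p.dropLast.length = p.length - 1 := by simp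
      rcases hg.dist_eq_dist_add_one_of_adj r hadj with h | h <;> omega
  choose par hroot hpar using hpar
  have huniq : ∀ x y, g.Adj y x → g.dist r x = g.dist r y + 1 → par x = y := by
    intro x y hyx hd
    have hx : x ≠ r := by rintro rfl; simp at hd
    obtain ⟨h1, h2⟩ := hpar x hx
    obtain ⟨p, hp⟩ := hg.connected.exists_walk_length_eq_dist r y
    obtain ⟨q, hq⟩ := hg.connected.exists_walk_length_eq_dist r (par x)
    have hp' : (p.concat hyx).IsPath := SimpleGraph.Walk.isPath_of_length_eq_dist _
      (by rw [SimpleGraph.Walk.length_concat, hp, hd])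
    have hq' : (q.concat h1).IsPath := SimpleGraph.Walk.isPath_of_length_eq_dist _
      (by rw [SimpleGraph.Walk.length_concat, hq, h2])
    have := congrArg SimpleGraph.Walk.penultimate ((hg.existsUnique_path r x).unique hq' hp')
    rwa [SimpleGraph.Walk.penultimate_concat, SimpleGraph.Walk.penultimate_concat] at this
  refine ⟨⟨r, g.dist r, par, fun x => ?_, fun x => ?_⟩, rfl, ?_⟩
  · rw [hg.connected.dist_eq_zero_iff, eq_comm]
  · by_cases hx : x = r
    · rw [hroot x hx, hx]; simp
    · have := (hpar x hx).2; omega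
  · ext x y
    constructor
    · rintro (⟨h1, h2⟩ | ⟨h1, h2⟩)
      · subst h1; exact (hpar y h2).1
      · subst h1; exact (hpar x h2).1.symm
    · intro h
      rcases hg.dist_eq_dist_add_one_of_adj r h with h' | h'
      · refine Or.inr ⟨huniq x y h.symm h', ?_⟩
        rintro rfl
        simp at h'
      · refine Or.inl ⟨huniq y x h h', ?_⟩
        rintro rfl
        simp at h'

end RTree

namespace TModel

variable {r p d : ℕ} {G G' : PGraph p}

/-- The leaf of a tree model representing a vertex. -/
def leaf (M : TModel r p d G) (u : G.V) : M.W := (M.leafEquiv u).1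

lemma dist_leaf (M : TModel r p d G) (u : G.V) : M.g.dist M.root (M.leaf u) = d :=
  (M.leafEquiv u).2

lemma leaf_injective (M : TModel r p d G) : Function.Injective M.leaf :=
  Subtype.val_injective.comp M.leafEquiv.injective

open Classical in
/-- The colouring of the tree of a tree model by the pairs of labels of its leaves. -/
noncomputable def color (M : TModel r p d G) (w : M.W) : Option (Fin r × Fin p) :=
  if h : M.g.dist M.root w = d then
    some (M.iLab (M.leafEquiv.symm ⟨w, h⟩), G.label (M.leafEquiv.symm ⟨w, h⟩))
  else none

lemma exists_leaf_eq_iff (M : TModel r p d G) (w : M.W) :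
    (∃ u, M.leaf u = w) ↔ M.g.dist M.root w = d := by
  constructor
  · rintro ⟨u, rfl⟩
    exact M.dist_leaf u
  · intro h
    exact ⟨M.leafEquiv.symm ⟨w, h⟩, by rw [leaf, Equiv.apply_symm_apply]⟩

lemma color_leaf (M : TModel r p d G) (u : G.V) :
    M.color (M.leaf u) = some (M.iLab u, G.label u) := by
  have h : (⟨M.leaf u, M.dist_leaf u⟩ : {w : M.W // M.g.dist M.root w = d}) = M.leafEquiv u := rfl
  rw [color, dif_pos (M.dist_leaf u), h, Equiv.symm_apply_apply]

lemma color_eq_none (M : TModel r p d G) {w : M.W} (h : M.g.dist M.root w ≠ d) :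
    M.color w = none := dif_neg h

lemma isSome_color_iff (M : TModel r p d G) (w : M.W) :
    (M.color w).isSome ↔ M.g.dist M.root w = d := by
  by_cases h : M.g.dist M.root w = d
  · obtain ⟨u, rfl⟩ := (M.exists_leaf_eq_iff w).2 h
    simp [color_leaf, M.dist_leaf]
  · simp [M.color_eq_none h, h]

lemma toStr_P_none (M : TModel r p d G) (w : M.W) : M.toStr.P none w ↔ w = M.root := Iff.rfl

lemma toStr_P_some (M : TModel r p d G) (k : Fin (r * p + 1)) (w : M.W) :
    M.toStr.P (some k) w ↔
      (∃ x, M.color w = some x ∧ (k : ℕ) = x.1 * p + x.2) ∨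
        (M.color w = none ∧ (k : ℕ) = r * p) := by
  change ((∃ h : M.g.dist M.root w = d, _) ∨ (¬ M.g.dist M.root w = d ∧ _)) ↔ _
  by_cases h : M.g.dist M.root w = d
  · simp [color, h]
  · simp [color, h]

lemma nonempty_of_tmodel (M : TModel r p d G) : Nonempty G.V := by
  have h : ∀ k ≤ d, ∃ w, M.g.dist M.root w = k := by
    intro k
    induction k with
    | zero => exact fun _ => ⟨M.root, SimpleGraph.dist_self⟩
    | succ k ih =>
      intro hk
      obtain ⟨w, hw⟩ := ih (by omega)
      obtain ⟨w', -, hw'⟩ := M.branch w (by omega)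
      exact ⟨w', by rw [hw', hw]⟩
  obtain ⟨w, hw⟩ := h d le_rfl
  exact ⟨M.leafEquiv.symm ⟨w, hw⟩⟩

/-- A rooted tree is the tree of a tree model. -/
structure Carries (M : TModel r p d G) (t : RTree M.W) : Prop where
  root : t.root = M.root
  graph : t.graph = M.g

lemma exists_carries (M : TModel r p d G) : ∃ t : RTree M.W, M.Carries t := by
  obtain ⟨t, h1, h2⟩ := RTree.exists_graph_eq M.tree M.root
  exact ⟨t, h1, h2⟩

namespace Carries

variable {M : TModel r p d G} {M' : TModel r p d G'} {t : RTree M.W} {t' : RTree M'.W}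

lemma depth (h : M.Carries t) (w : M.W) : t.depth w = M.g.dist M.root w := by
  rw [← t.dist_graph_root, h.root, h.graph]

lemma depth_le (h : M.Carries t) (w : M.W) : t.depth w ≤ d := by
  rw [h.depth]
  exact M.depthLe w

lemma depth_leaf (h : M.Carries t) (u : G.V) : t.depth (M.leaf u) = d := by
  rw [h.depth, M.dist_leaf]

lemma adj_iff (h : M.Carries t) (u v : G.V) :
    G.adj u v ↔ u ≠ v ∧ (M.iLab u, M.iLab v, t.lca (M.leaf u) (M.leaf v)) ∈ M.S := by
  by_cases huv : u = v
  · subst huv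
    simp [G.irrefl]
  · rw [M.edge_iff u v huv (t.lca (M.leaf u) (M.leaf v))]
    · simp [huv]
    · rw [← t.dist_graph_eq (by rw [h.depth_leaf, h.depth_leaf]), h.graph]
      rfl

lemma livesOn_graph (h : M.Carries t) : t.LivesOn G.toStr M.leaf {d} where
  inj := M.leaf_injective
  range w := by
    rw [Set.mem_singleton_iff, h.depth]
    exact M.exists_leaf_eq_iff w

lemma livesOn_tree (_ : M.Carries t) : t.LivesOn M.toStr id Set.univ where
  inj := Function.injective_id
  range w := ⟨fun _ => Set.mem_univ _, fun _ => ⟨w, rfl⟩⟩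

lemma sat_graph_iff (h : M.Carries t) (h' : M'.Carries t') (hS : M.S = M'.S)
    {φ : MSOForm (Fin p)} (hφ : φ.IsSentence)
    (hty : t.ty (RTree.thr φ.qr (Option (Fin r × Fin p))) M.color d t.root =
      t'.ty (RTree.thr φ.qr (Option (Fin r × Fin p))) M'.color d t'.root) :
    G.toStr.Sat φ ↔ G'.toStr.Sat φ := by
  have : Nonempty G.toStr.V := M.nonempty_of_tmodel
  have : Nonempty G'.toStr.V := M'.nonempty_of_tmodel
  have hcol : ∀ (u : G.V) (u' : G'.V) (g : M.W → M'.W), RTree.IsHom t t' M.color M'.color g →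
      g (M.leaf u) = M'.leaf u' → M'.iLab u' = M.iLab u ∧ G'.label u' = G.label u := by
    intro u u' g hg e
    have := hg.color (M.leaf u)
    rw [e, M.color_leaf, M'.color_leaf] at this
    simpa using this
  refine RTree.sat_iff h.depth_le h'.depth_le h.livesOn_graph h'.livesOn_graph ?_ ?_ hφ hty
  · rintro (x : G.V) (y : G.V) (x' : G'.V) (y' : G'.V) ⟨g, hg, hx, hy⟩ ⟨g', hg', hx', hy'⟩
    change G.adj x y ↔ G'.adj x' y'
    have hlca : t.lca (M.leaf x) (M.leaf y) = t'.lca (M'.leaf x') (M'.leaf y') := by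
      refine le_antisymm ?_ ?_
      · have := hg'.lca_le (u := M'.leaf x') (v := M'.leaf y')
          (by rw [h'.depth_leaf, h'.depth_leaf])
        rwa [hx', hy'] at this
      · have := hg.lca_le (u := M.leaf x) (v := M.leaf y) (by rw [h.depth_leaf, h.depth_leaf])
        rwa [hx, hy] at this
    have hne : x = y ↔ x' = y' := by
      constructor
      · rintro rfl
        exact M'.leaf_injective (hx.symm.trans hy)
      · rintro rfl
        exact M.leaf_injective (hx'.symm.trans hy')
    rw [h.adj_iff, h'.adj_iff, hlca, hS, (hcol x x' g hg hx).1, (hcol y y' g hg hy).1, ne_eq, hne]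
  · rintro a (x : G.V) (x' : G'.V) ⟨g, hg, hx⟩ -
    change G.label x = a ↔ G'.label x' = a
    rw [(hcol x x' g hg hx).2]

lemma sat_tree_iff (h : M.Carries t) (h' : M'.Carries t')
    {φ : MSOForm (Option (Fin (r * p + 1)))} (hφ : φ.IsSentence)
    (hty : t.ty (RTree.thr φ.qr (Option (Fin r × Fin p))) M.color d t.root =
      t'.ty (RTree.thr φ.qr (Option (Fin r × Fin p))) M'.color d t'.root) :
    M.toStr.Sat φ ↔ M'.toStr.Sat φ := by
  have : Nonempty M.toStr.V := ⟨M.root⟩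
  have : Nonempty M'.toStr.V := ⟨M'.root⟩
  refine RTree.sat_iff h.depth_le h'.depth_le h.livesOn_tree h'.livesOn_tree ?_ ?_ hφ hty
  · rintro (x : M.W) (y : M.W) _ _ ⟨g, hg, rfl, rfl⟩ ⟨g', hg', hx', hy'⟩
    change M.g.Adj x y ↔ M'.g.Adj (g x) (g y)
    rw [← h.graph, ← h'.graph]
    refine ⟨fun e => e.imp hg.child hg.child, fun e => ?_⟩
    have := e.imp hg'.child hg'.child
    have hx : g' (g x) = x := hx'
    have hy : g' (g y) = y := hy'
    rwa [hx, hy] at this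
  · rintro a (x : M.W) _ ⟨g, hg, rfl⟩ -
    change M.toStr.P a x ↔ M'.toStr.P a (g x)
    cases a with
    | none =>
      rw [toStr_P_none, toStr_P_none, ← h.root, ← h'.root, ← t.depth_eq_zero, ← t'.depth_eq_zero,
        hg.depth]
    | some k => rw [toStr_P_some, toStr_P_some, hg.color]

end Carries

/-- A rooted tree all of whose branches have length `d`, with pairs of labels on its leaves,
determines a labeled graph and a tree model of it. -/
lemma exists_of_tree {W : Type} (t : RTree W) (c : W → Option (Fin r × Fin p))
    (hd : ∀ x, t.depth x ≤ d) (hc : ∀ x, (c x).isSome ↔ t.depth x = d)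
    (hb : ∀ x, t.depth x < d → ∃ a, t.Child x a) (S : Set (Fin r × Fin r × ℕ))
    (S_range : ∀ x ∈ S, 1 ≤ x.2.2 ∧ x.2.2 ≤ d) (S_symm : ∀ i j l, (i, j, l) ∈ S ↔ (j, i, l) ∈ S) :
    ∃ G : PGraph p, (Countable W → Countable G.V) ∧ ∃ M : TModel r p d G, M.S = S ∧
      ∃ t' : RTree M.W, M.Carries t' ∧
        ∀ N h, t.ty N c h t.root = t'.ty N M.color h t'.root := by
  let lab : {w // t.depth w = d} → Fin r × Fin p := fun u => (c u.1).get ((hc u.1).2 u.2)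
  let G : PGraph p :=
    { V := {w // t.depth w = d}
      adj := fun u v => u ≠ v ∧ ((lab u).1, (lab v).1, t.lca u.1 v.1) ∈ S
      symm := fun u v h => ⟨h.1.symm, by rw [t.lca_comm, ← S_symm]; exact h.2⟩
      irrefl := fun v h => h.1 rfl
      label := fun u => (lab u).2 }
  let M : TModel r p d G :=
    { W := W
      g := t.graph
      tree := t.isTree_graph
      root := t.root
      depthLe := fun w => by rw [t.dist_graph_root]; exact hd w
      branch := fun w hw => by
        rw [t.dist_graph_root] at hw
        obtain ⟨a, ha⟩ := hb w hw
        exact ⟨a, Or.inl ha, by rw [t.dist_graph_root, t.dist_graph_root, ha.depth]⟩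
      leafEquiv := Equiv.subtypeEquivRight fun w => by rw [t.dist_graph_root]
      iLab := fun u => (lab u).1
      S := S
      S_range := S_range
      S_symm := S_symm
      edge_iff := fun u v huv l hl => by
        have h := t.dist_graph_eq (u := u.1) (v := v.1) (by rw [u.2, v.2])
        have hl' : t.graph.dist u.1 v.1 = 2 * l := hl
        have : l = t.lca u.1 v.1 := by omega
        subst this
        exact and_iff_right huv }
  refine ⟨G, fun _ => inferInstanceAs (Countable {w // t.depth w = d}), M, rfl, t,
    ⟨rfl, rfl⟩, fun N h => ?_⟩
  have hcol : M.color = c := by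
    funext w
    by_cases hw : t.depth w = d
    · have := M.color_leaf (⟨w, hw⟩ : {w // t.depth w = d})
      refine this.trans ?_
      change some (lab ⟨w, hw⟩) = c w
      simp [lab]
    · rw [M.color_eq_none (w := w) (by rw [← t.dist_graph_root] at hw; exact hw)]
      have := mt (hc w).1 hw
      rw [Bool.not_eq_true, Option.isSome_eq_false_iff, Option.isNone_iff_eq_none] at this
      exact this.symm
  rw [hcol]

end TModel

/-- MSO compactness over `TM(r,p,d; θ, 𝒮)`: if every finite subset of a set `T`
of MSO sentences over the vocabulary of `p`-labeled graphs is satisfiable in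
`TM(r,p,d; θ, 𝒮)`, then `T` is satisfiable in `TM(r,p,d; θ, 𝒮)`, and indeed by
an at most countable model. -/
theorem stmt15 (d r p : ℕ) (θ : MSOForm (Option (Fin (r * p + 1))))
    (hθ : θ.IsSentence) (Sig : Set (Set (Fin r × Fin r × ℕ)))
    (T : Set (MSOForm (Fin p))) (hT : ∀ φ ∈ T, φ.IsSentence)
    (hfin : ∀ T₀ : Set (MSOForm (Fin p)), T₀ ⊆ T → T₀.Finite →
      ∃ G ∈ TMc r p d θ Sig, ∀ φ ∈ T₀, G.toStr.Sat φ) :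
    ∃ G ∈ TMc r p d θ Sig, Countable G.V ∧ ∀ φ ∈ T, G.toStr.Sat φ := by
  classical
  let U : Ultrafilter (Finset T) := Ultrafilter.of Filter.atTop
  have hU : ∀ φ : T, ∀ᶠ n in (U : Filter (Finset T)), φ ∈ n := fun φ =>
    Ultrafilter.of_le _ ((Filter.eventually_ge_atTop {φ}).mono fun n hn =>
      hn (Finset.mem_singleton_self φ))
  have hch : ∀ n : Finset T, ∃ (G : PGraph p) (M : TModel r p d G) (t : RTree M.W),
      M.Carries t ∧ M.S ∈ Sig ∧ M.toStr.Sat θ ∧ ∀ φ ∈ n, G.toStr.Sat φ.1 := by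
    intro n
    obtain ⟨G, ⟨M, hS, hM⟩, hG⟩ := hfin (Subtype.val '' (n : Set T))
      (by rintro _ ⟨φ, -, rfl⟩; exact φ.2) (n.finite_toSet.image _)
    obtain ⟨t, ht⟩ := M.exists_carries
    exact ⟨G, M, t, ht, hS, hM, fun φ hφ => hG _ ⟨φ, hφ, rfl⟩⟩
  choose G M t ht hS hθM hG using hch
  obtain ⟨W', hW', t', c', hty, hloc⟩ := RTree.exists_limit U t (fun n => (M n).color)
    (fun n => (ht n).depth_le) fun m => RTree.thr m (Option (Fin r × Fin p))
  obtain ⟨S', hS'⟩ := U.exists_eventually_eq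
    fun n => {x : Fin r × Fin r × Fin (d + 1) | (x.1, x.2.1, (x.2.2 : ℕ)) ∈ (M n).S}
  obtain ⟨n₀, hn₀⟩ := hS'.exists
  have hSeq : ∀ᶠ n in (U : Filter (Finset T)), (M n).S = (M n₀).S := by
    refine hS'.mono fun n hn => ?_
    have key : ∀ x : Fin r × Fin r × Fin (d + 1),
        (x.1, x.2.1, (x.2.2 : ℕ)) ∈ (M n).S ↔ (x.1, x.2.1, (x.2.2 : ℕ)) ∈ (M n₀).S :=
      fun x => Set.ext_iff.1 (hn.trans hn₀.symm) x
    ext ⟨i, j, l⟩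
    by_cases hl : l ≤ d
    · exact key (i, j, ⟨l, by omega⟩)
    · exact ⟨fun h => absurd ((M n).S_range _ h).2 hl, fun h => absurd ((M n₀).S_range _ h).2 hl⟩
  obtain ⟨G', hcount, M', hM'S, t'', hM't, hty'⟩ := TModel.exists_of_tree (d := d) t' c'
    (fun x => by
      obtain ⟨n, y, hy, -⟩ := (hloc x).exists
      rw [← hy]
      exact (ht n).depth_le y)
    (fun x => by
      obtain ⟨n, y, hy, hc, -⟩ := (hloc x).exists
      rw [← hy, ← hc, (ht n).depth]
      exact (M n).isSome_color_iff y)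
    (fun x hx => by
      obtain ⟨n, y, hy, -, ha⟩ := (hloc x).exists
      refine ha ?_
      rw [← hy, (ht n).depth] at hx
      obtain ⟨a, hadj, hda⟩ := (M n).branch y hx
      rw [← (ht n).graph] at hadj
      rcases hadj with h | h
      · exact ⟨a, h⟩
      · have := h.depth
        rw [(ht n).depth, (ht n).depth] at this
        omega)
    (M n₀).S (M n₀).S_range (M n₀).S_symm
  refine ⟨G', ⟨M', hM'S ▸ hS n₀, ?_⟩, hcount hW', fun φ hφ => ?_⟩
  · obtain ⟨n, hn⟩ := (hty θ.qr d).exists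
    exact ((ht n).sat_tree_iff hM't hθ (hn.trans (hty' _ _))).1 (hθM n)
  · obtain ⟨n, hn, hnφ, hnS⟩ := ((hty φ.qr d).and ((hU ⟨φ, hφ⟩).and hSeq)).exists
    exact ((ht n).sat_graph_iff hM't (hnS.trans hM'S.symm) (hT φ hφ)
      (hn.trans (hty' _ _))).1 (hG n _ hnφ)
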